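/- arXiv:2009.04698 — 2 statements merged into one kernel-verified Lean document; each statement's English description precedes it below -/
import Mathlib

section
/- Let δ ≥ 1 and let H be a proper δ-hyperbolic Busemann space with fixed base point w ∈ H and boundary point a ∈ ∂H. Let x, y, m ∈ H with h(m) ≤ h(x) ≤ h(y) and let α : [0,T] → H be a path connecting x to y such that h⁻(α) = h(m). With ΔH = h(y) + ½·d_r(x,y) − h⁺(α), one has l(α) ≥ 2·Δh(x,m) + d(x,y) + 2^{−850}·2^{ΔH/δ} − 1 − max(0, 2ΔH) − 1700δ. -/
open Set Filter
open scoped ENNReal NNReal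

noncomputable section

namespace HP

variable {H : Type*} [MetricSpace H]

/-- `γ` restricted to `I` is an arclength-parametrised (isometric) geodesic. -/
def IsGeodesicOn (γ : ℝ → H) (I : Set ℝ) : Prop :=
  ∀ s ∈ I, ∀ t ∈ I, dist (γ s) (γ t) = |s - t|

/-- A geodesic line of `H`. -/
def IsGeodesicLine (γ : ℝ → H) : Prop := IsGeodesicOn γ Set.univ

/-- A geodesic ray of `H`, parametrised on `[0,∞)`. -/
def IsGeodesicRay (γ : ℝ → H) : Prop := IsGeodesicOn γ (Set.Ici 0)

/-- A geodesic ray starting at `w`. -/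
def IsRayFrom (w : H) (γ : ℝ → H) : Prop := IsGeodesicRay γ ∧ γ 0 = w

/-- A geodesic segment from `x` to `y`, parametrised on `[0, dist x y]`. -/
def IsGeodSegment (γ : ℝ → H) (x y : H) : Prop :=
  IsGeodesicOn γ (Set.Icc 0 (dist x y)) ∧ γ 0 = x ∧ γ (dist x y) = y

/-- The traces on `[0,∞)` of two rays are at finite Hausdorff distance. -/
def FinHausRays (γ₁ γ₂ : ℝ → H) : Prop :=
  ∃ C : ℝ, (∀ s : ℝ, 0 ≤ s → ∃ t : ℝ, 0 ≤ t ∧ dist (γ₁ s) (γ₂ t) ≤ C) ∧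
           (∀ t : ℝ, 0 ≤ t → ∃ s : ℝ, 0 ≤ s ∧ dist (γ₁ s) (γ₂ t) ≤ C)

/-- A geodesic metric space: any two points are joined by a geodesic segment. -/
def GeodesicSpace (H : Type*) [MetricSpace H] : Prop :=
  ∀ x y : H, ∃ γ : ℝ → H, IsGeodSegment γ x y

/-- `δ`-hyperbolicity: geodesic space all of whose geodesic triangles are `δ`-slim,
i.e. each side is contained in the `δ`-neighbourhood of the union of the other two. -/
def DeltaHyperbolic (H : Type*) [MetricSpace H] (δ : ℝ) : Prop :=
  GeodesicSpace H ∧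
  ∀ x y z : H, ∀ γ₁ γ₂ γ₃ : ℝ → H,
    IsGeodSegment γ₁ x y → IsGeodSegment γ₂ y z → IsGeodSegment γ₃ z x →
    ∀ s ∈ Set.Icc (0:ℝ) (dist x y),
      ∃ u ∈ γ₂ '' Set.Icc (0:ℝ) (dist y z) ∪ γ₃ '' Set.Icc (0:ℝ) (dist z x),
        dist (γ₁ s) u ≤ δ

/-- A Busemann space: geodesic, and the distance between any two
arclength-parametrised geodesics is a convex function. -/
def BusemannSpace (H : Type*) [MetricSpace H] : Prop :=
  GeodesicSpace H ∧
  ∀ (a b a' b' : ℝ) (γ γ' : ℝ → H),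
    IsGeodesicOn γ (Set.Icc a b) → IsGeodesicOn γ' (Set.Icc a' b') →
    ConvexOn ℝ (Set.Icc a b ×ˢ Set.Icc a' b')
      (fun p : ℝ × ℝ => dist (γ p.1) (γ' p.2))

/-- Geodesic completeness: every geodesic segment extends to a geodesic line. -/
def GeodesicallyComplete (H : Type*) [MetricSpace H] : Prop :=
  ∀ (a b : ℝ) (γ : ℝ → H), a ≤ b → IsGeodesicOn γ (Set.Icc a b) →
    ∃ γ' : ℝ → H, IsGeodesicLine γ' ∧ ∀ t ∈ Set.Icc a b, γ' t = γ t

/-- The Busemann function with respect to the boundary point represented by the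
geodesic ray `aRep` and the base point `w`. -/
def busemann (w : H) (aRep : ℝ → H) (x : H) : ℝ :=
  sSup { b : ℝ | ∃ k : ℝ → H, IsRayFrom w k ∧ FinHausRays aRep k ∧
    b = Filter.limsup (fun t => dist x (k t) - t) Filter.atTop }

/-- The height function: minus the Busemann function. -/
def height (w : H) (aRep : ℝ → H) (x : H) : ℝ := - busemann w aRep x

/-- A vertical geodesic (forward oriented): a geodesic line whose height tends to `+∞`. -/
def IsVerticalGeodesic (w : H) (aRep : ℝ → H) (V : ℝ → H) : Prop :=
  IsGeodesicLine V ∧ Tendsto (fun t => height w aRep (V t)) atTop atTop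

/-- A vertical geodesic line (either orientation): a geodesic line whose image lies
in the boundary class, i.e. whose height tends to `+∞` along one of its ends. -/
def IsVerticalGeodesicLine (w : H) (aRep : ℝ → H) (V : ℝ → H) : Prop :=
  IsGeodesicLine V ∧
    (Tendsto (fun t => height w aRep (V t)) atTop atTop ∨
     Tendsto (fun t => height w aRep (V t)) atBot atTop)

/-- A vertical geodesic parametrised by its height: `h(V(t)) = t` for all `t`. -/
def VertParam (w : H) (aRep : ℝ → H) (V : ℝ → H) : Prop :=
  IsGeodesicLine V ∧ ∀ t : ℝ, height w aRep (V t) = t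

/-- Height difference `Δh(x,y)`. -/
def dh (w : H) (aRep : ℝ → H) (x y : H) : ℝ :=
  |height w aRep x - height w aRep y|

/-- Relative distance `d_r(x,y) = d(x,y) - Δh(x,y)`. -/
def dr (w : H) (aRep : ℝ → H) (x y : H) : ℝ := dist x y - dh w aRep x y

/-- Maximal height `h⁺` of a path along the parameter set `I`. -/
def hplusOn (w : H) (aRep : ℝ → H) (γ : ℝ → H) (I : Set ℝ) : ℝ :=
  sSup ((fun t => height w aRep (γ t)) '' I)

/-- Minimal height `h⁻` of a path along the parameter set `I`. -/
def hminusOn (w : H) (aRep : ℝ → H) (γ : ℝ → H) (I : Set ℝ) : ℝ :=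
  sInf ((fun t => height w aRep (γ t)) '' I)

/-- A path parametrised by arclength: the length of the piece on `[s,t]` equals `t - s`. -/
def ArclengthPath (V : ℝ → H) : Prop :=
  ∀ s t : ℝ, s ≤ t → eVariationOn V (Set.Icc s t) = ENNReal.ofReal (t - s)

/-- An admissible norm on `ℝ²`: a norm with `N(1,1) = 1` and `N(a,b) ≥ (a+b)/2`. -/
structure AdmNorm where
  toFun : ℝ × ℝ → ℝ
  eq_zero_iff : ∀ v : ℝ × ℝ, toFun v = 0 ↔ v = 0
  smul_eq : ∀ (c : ℝ) (v : ℝ × ℝ), toFun (c • v) = |c| * toFun v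
  add_le : ∀ v w : ℝ × ℝ, toFun (v + w) ≤ toFun v + toFun w
  one_one : toFun (1, 1) = 1
  adm : ∀ a b : ℝ, (a + b) / 2 ≤ toFun (a, b)

/-- `C` is a comparison constant `C_N` for the admissible norm `N`:
`C ≥ 1` and `N(a,b) ≤ C(a+b)/2` for all `a,b ≥ 0`. -/
def AdmNorm.BoundConst (N : AdmNorm) (C : ℝ) : Prop :=
  1 ≤ C ∧ ∀ a b : ℝ, 0 ≤ a → 0 ≤ b → N.toFun (a, b) ≤ C * (a + b) / 2

variable {Hp Hq : Type*} [MetricSpace Hp] [MetricSpace Hq]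

/-- Membership in the horospherical product: `h_p(x_p) + h_q(x_q) = 0`. -/
def inHoro (wp : Hp) (ap : ℝ → Hp) (wq : Hq) (aq : ℝ → Hq) (z : Hp × Hq) : Prop :=
  height wp ap z.1 + height wq aq z.2 = 0

/-- The `N`-length of a path in `Hp × Hq`: supremum over finite monotone
subdivisions of the sums of the `N(d_p, d_q)`-distances. -/
def lN (Nf : ℝ × ℝ → ℝ) (γ : ℝ → Hp × Hq) (s : Set ℝ) : ℝ≥0∞ :=
  ⨆ p : ℕ × { u : ℕ → ℝ // Monotone u ∧ ∀ i, u i ∈ s },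
    ∑ i ∈ Finset.range p.1,
      ENNReal.ofReal (Nf (dist (γ (p.2.1 (i+1))).1 (γ (p.2.1 i)).1,
                          dist (γ (p.2.1 (i+1))).2 (γ (p.2.1 i)).2))

/-- The `N`-path metric: infimum of `N`-lengths of connected paths staying in the
horospherical product and joining the two points. -/
def dHN (Nf : ℝ × ℝ → ℝ) (mem : Hp × Hq → Prop) (x y : Hp × Hq) : ℝ≥0∞ :=
  ⨅ (T : ℝ) (_ : 0 ≤ T) (γ : ℝ → Hp × Hq) (_ : ContinuousOn γ (Set.Icc 0 T))
    (_ : ∀ t ∈ Set.Icc (0:ℝ) T, mem (γ t)) (_ : γ 0 = x) (_ : γ T = y),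
    lN Nf γ (Set.Icc 0 T)

/-- A geodesic of the horospherical product with respect to the `N`-path metric,
parametrised (by arclength) on `I` and staying in the product. -/
def IsHNGeodesicOn (Nf : ℝ × ℝ → ℝ) (mem : Hp × Hq → Prop)
    (α : ℝ → Hp × Hq) (I : Set ℝ) : Prop :=
  (∀ t ∈ I, mem (α t)) ∧
  ∀ s ∈ I, ∀ t ∈ I, dHN Nf mem (α s) (α t) = ENNReal.ofReal |s - t|

/-- A vertical geodesic of the horospherical product, parametrised by its height. -/
def IsHNVerticalLine (Nf : ℝ × ℝ → ℝ) (mem : Hp × Hq → Prop)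
    (wp : Hp) (ap : ℝ → Hp) (V : ℝ → Hp × Hq) : Prop :=
  IsHNGeodesicOn Nf mem V Set.univ ∧ ∀ t : ℝ, height wp ap (V t).1 = t

/-- Maximal height `h⁺` of a path of the horospherical product. -/
def hplusH (wp : Hp) (ap : ℝ → Hp) (γ : ℝ → Hp × Hq) (I : Set ℝ) : ℝ :=
  sSup ((fun t => height wp ap (γ t).1) '' I)

/-- Minimal height `h⁻` of a path of the horospherical product. -/
def hminusH (wp : Hp) (ap : ℝ → Hp) (γ : ℝ → Hp × Hq) (I : Set ℝ) : ℝ :=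
  sInf ((fun t => height wp ap (γ t).1) '' I)

/-- `H_p`-type path at scale `κ`: the first component stays `κ`-close to a geodesic
of `H_p` and the second component stays `κ`-close to a vertical geodesic of `H_q`. -/
def IsHpType (wq : Hq) (aq : ℝ → Hq) (κ : ℝ) (α : ℝ → Hp × Hq) : Prop :=
  (∃ g : ℝ → Hp, IsGeodesicLine g ∧ ∀ t : ℝ, ∃ s : ℝ, dist (α t).1 (g s) ≤ κ) ∧
  (∃ v : ℝ → Hq, IsVerticalGeodesicLine wq aq v ∧ ∀ t : ℝ, ∃ s : ℝ, dist (α t).2 (v s) ≤ κ)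

/-- `H_q`-type path at scale `κ`. -/
def IsHqType (wp : Hp) (ap : ℝ → Hp) (κ : ℝ) (α : ℝ → Hp × Hq) : Prop :=
  (∃ g : ℝ → Hq, IsGeodesicLine g ∧ ∀ t : ℝ, ∃ s : ℝ, dist (α t).2 (g s) ≤ κ) ∧
  (∃ v : ℝ → Hp, IsVerticalGeodesicLine wp ap v ∧ ∀ t : ℝ, ∃ s : ℝ, dist (α t).1 (v s) ≤ κ)

/-- Finite Hausdorff distance on `[0,∞)` between two rays, for a generalized
(`ℝ≥0∞`-valued) distance `dd`. -/
def HNFinHaus {X : Type*} (dd : X → X → ℝ≥0∞) (α β : ℝ → X) : Prop :=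
  ∃ C : ℝ, (∀ s : ℝ, 0 ≤ s → ∃ t : ℝ, 0 ≤ t ∧ dd (α s) (β t) ≤ ENNReal.ofReal C) ∧
           (∀ t : ℝ, 0 ≤ t → ∃ s : ℝ, 0 ≤ s ∧ dd (α s) (β t) ≤ ENNReal.ofReal C)

theorem finHaus_equivalence (H : Type*) [MetricSpace H] :
    Equivalence (fun γ₁ γ₂ : {γ : ℝ → H // IsGeodesicRay γ} => FinHausRays γ₁.1 γ₂.1) := by
  constructor
  · intro γ
    exact ⟨0, fun s hs => ⟨s, hs, by simp⟩, fun t ht => ⟨t, ht, by simp⟩⟩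
  · rintro γ₁ γ₂ ⟨C, h1, h2⟩
    refine ⟨C, fun s hs => ?_, fun t ht => ?_⟩
    · obtain ⟨u, hu, hd⟩ := h2 s hs
      exact ⟨u, hu, by rwa [dist_comm]⟩
    · obtain ⟨u, hu, hd⟩ := h1 t ht
      exact ⟨u, hu, by rwa [dist_comm]⟩
  · rintro γ₁ γ₂ γ₃ ⟨C, h1, h2⟩ ⟨D, g1, g2⟩
    refine ⟨C + D, fun s hs => ?_, fun t ht => ?_⟩
    · obtain ⟨u, hu, hd⟩ := h1 s hs
      obtain ⟨v, hv, he⟩ := g1 u hu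
      exact ⟨v, hv, (dist_triangle _ (γ₂.1 u) _).trans (add_le_add hd he)⟩
    · obtain ⟨u, hu, hd⟩ := g2 t ht
      obtain ⟨v, hv, he⟩ := h2 u hu
      exact ⟨v, hv, (dist_triangle _ (γ₂.1 u) _).trans (add_le_add he hd)⟩

/-- The setoid of geodesic rays up to finite Hausdorff distance. -/
instance raySetoid (H : Type*) [MetricSpace H] : Setoid {γ : ℝ → H // IsGeodesicRay γ} :=
  ⟨fun γ₁ γ₂ => FinHausRays γ₁.1 γ₂.1, finHaus_equivalence H⟩

/-- The Gromov boundary: equivalence classes of geodesic rays at finite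
Hausdorff distance. -/
abbrev Bdry (H : Type*) [MetricSpace H] := Quotient (raySetoid H)

/-- The boundary point determined by a geodesic ray. -/
def bdryPt {H : Type*} [MetricSpace H] (γ : ℝ → H) (h : IsGeodesicRay γ) : Bdry H :=
  Quotient.mk (raySetoid H) ⟨γ, h⟩

/-- The set `((∂H_p ∖ {a_p}) × {a_q}) ∪ ({a_p} × (∂H_q ∖ {a_q}))`. -/
def bdryTarget {Hp Hq : Type*} [MetricSpace Hp] [MetricSpace Hq]
    (ap : ℝ → Hp) (hap : IsGeodesicRay ap)
    (aq : ℝ → Hq) (haq : IsGeodesicRay aq) : Set (Bdry Hp × Bdry Hq) :=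
  ((({bdryPt ap hap} : Set (Bdry Hp))ᶜ ×ˢ ({bdryPt aq haq} : Set (Bdry Hq))) ∪
   (({bdryPt ap hap} : Set (Bdry Hp)) ×ˢ ({bdryPt aq haq} : Set (Bdry Hq))ᶜ))

/-! ### Geodesic segments -/

/-- The point `p` lies on some geodesic segment from `x` to `y`. -/
def OnSegment (x y p : H) : Prop :=
  ∃ γ : ℝ → H, IsGeodSegment γ x y ∧ ∃ s ∈ Set.Icc (0:ℝ) (dist x y), γ s = p

theorem IsGeodSegment.reverse {γ : ℝ → H} {x y : H} (h : IsGeodSegment γ x y) :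
    IsGeodSegment (fun t => γ (dist x y - t)) y x := by
  obtain ⟨h1, h2, h3⟩ := h
  refine ⟨fun s hs t ht => ?_, by simpa using h3, by simpa [dist_comm y x] using h2⟩
  rw [dist_comm y x] at hs ht
  have := h1 (dist x y - s) ⟨by linarith [hs.2], by linarith [hs.1]⟩
    (dist x y - t) ⟨by linarith [ht.2], by linarith [ht.1]⟩
  rw [this, abs_sub_comm s t]
  congr 1
  ring

theorem OnSegment.symm {x y p : H} (h : OnSegment x y p) : OnSegment y x p := by
  obtain ⟨γ, hγ, s, hs, rfl⟩ := h
  refine ⟨_, hγ.reverse, dist x y - s, ?_, by simp⟩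
  rw [dist_comm y x]
  exact ⟨by linarith [hs.2], by linarith [hs.1]⟩

theorem IsGeodSegment.dist_left {γ : ℝ → H} {x y : H} (h : IsGeodSegment γ x y)
    {s : ℝ} (hs : s ∈ Set.Icc (0:ℝ) (dist x y)) : dist x (γ s) = s := by
  have := h.1 0 ⟨le_rfl, dist_nonneg⟩ s hs
  rw [h.2.1] at this
  rw [this, zero_sub, abs_neg, abs_of_nonneg hs.1]

theorem IsGeodSegment.dist_right {γ : ℝ → H} {x y : H} (h : IsGeodSegment γ x y)
    {s : ℝ} (hs : s ∈ Set.Icc (0:ℝ) (dist x y)) : dist (γ s) y = dist x y - s := by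
  have := h.1 s hs (dist x y) ⟨dist_nonneg, le_rfl⟩
  rw [h.2.2] at this
  rw [this, abs_sub_comm, abs_of_nonneg (by linarith [hs.2])]

theorem OnSegment.dist_add_dist {x y p : H} (h : OnSegment x y p) :
    dist x p + dist p y = dist x y := by
  obtain ⟨γ, hγ, s, hs, rfl⟩ := h
  rw [hγ.dist_left hs, hγ.dist_right hs]
  ring

theorem IsGeodesicOn.continuousOn {γ : ℝ → H} {I : Set ℝ} (h : IsGeodesicOn γ I) :
    ContinuousOn γ I := by
  refine (LipschitzOnWith.of_dist_le_mul (K := 1) fun s hs t ht => ?_).continuousOn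
  rw [h s hs t ht, Real.dist_eq]
  simp

/-- A point on one side of a triangle is `δ`-close to a point of one of the other two sides. -/
theorem DeltaHyperbolic.exists_onSegment {δ : ℝ} (hH : DeltaHyperbolic H δ) {x y p : H}
    (hp : OnSegment x y p) (z : H) :
    ∃ q, dist p q ≤ δ ∧ (OnSegment x z q ∨ OnSegment z y q) := by
  obtain ⟨γ, hγ, s, hs, rfl⟩ := hp
  obtain ⟨γ₂, hγ₂⟩ := hH.1 y z
  obtain ⟨γ₃, hγ₃⟩ := hH.1 z x
  obtain ⟨q, hq, hd⟩ := hH.2 x y z γ γ₂ γ₃ hγ hγ₂ hγ₃ s hs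
  refine ⟨q, hd, ?_⟩
  rcases hq with ⟨t, ht, rfl⟩ | ⟨t, ht, rfl⟩
  · exact Or.inr (OnSegment.symm ⟨γ₂, hγ₂, t, ht, rfl⟩)
  · exact Or.inl (OnSegment.symm ⟨γ₃, hγ₃, t, ht, rfl⟩)

/-- Each side `[x, y]` of a triangle contains a point which lies, up to `2δ`, on geodesics
from `x` and from `y` to the third vertex. -/
theorem DeltaHyperbolic.exists_center {δ : ℝ} (hH : DeltaHyperbolic H δ) (x y z : H) :
    ∃ p, OnSegment x y p ∧ dist x p + dist p z ≤ dist x z + 2 * δ ∧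
      dist y p + dist p z ≤ dist y z + 2 * δ := by
  obtain ⟨γ, hγ⟩ := hH.1 x y
  have hγc := hγ.1.continuousOn
  have hz : ContinuousOn (fun s => dist (γ s) z) (Set.Icc 0 (dist x y)) :=
    (continuous_id.dist continuous_const).comp_continuousOn hγc
  have hc : ContinuousOn (fun s => (dist (γ s) z + s - dist x z) -
      (dist (γ s) z + (dist x y - s) - dist y z)) (Set.Icc 0 (dist x y)) := by
    fun_prop
  have h0 : (0:ℝ) ∈ Set.Icc ((dist (γ 0) z + 0 - dist x z) -
      (dist (γ 0) z + (dist x y - 0) - dist y z))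
      ((dist (γ (dist x y)) z + dist x y - dist x z) -
      (dist (γ (dist x y)) z + (dist x y - dist x y) - dist y z)) := by
    rw [hγ.2.1, hγ.2.2]
    constructor <;> linarith [dist_triangle y x z, dist_triangle x y z, dist_comm x y]
  obtain ⟨s, hs, hfg⟩ := intermediate_value_Icc dist_nonneg hc h0
  have hfg : (dist (γ s) z + s - dist x z) -
      (dist (γ s) z + (dist x y - s) - dist y z) = 0 := hfg
  have hp : OnSegment x y (γ s) := ⟨γ, hγ, s, hs, rfl⟩
  have h1 := hγ.dist_left hs
  have h2 := hγ.dist_right hs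
  rw [dist_comm] at h2
  refine ⟨γ s, hp, ?_⟩
  rw [h1, h2]
  obtain ⟨q, hq, hq' | hq'⟩ := hH.exists_onSegment hp z
  · have := hq'.dist_add_dist
    have a1 := dist_triangle x q (γ s)
    have a2 := dist_triangle (γ s) q z
    rw [dist_comm q (γ s)] at a1
    constructor <;> linarith
  · have := hq'.dist_add_dist
    have a1 := dist_triangle (γ s) q y
    have a2 := dist_triangle (γ s) q z
    rw [dist_comm (γ s) y] at a1
    rw [dist_comm z q, dist_comm z y] at this
    constructor <;> linarith

/-! ### The height function -/

/-- In a Busemann space two asymptotic rays with the same origin coincide. -/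
theorem BusemannSpace.ray_unique (hB : BusemannSpace H) {w : H} {a k : ℝ → H}
    (ha : IsRayFrom w a) (hk : IsRayFrom w k) (hak : FinHausRays a k) {t : ℝ} (ht : 0 ≤ t) :
    k t = a t := by
  obtain ⟨C, hC, -⟩ := hak
  have hdist : ∀ s, 0 ≤ s → dist (a s) (k s) ≤ 2 * C := by
    intro s hs
    obtain ⟨u, hu, hd⟩ := hC s hs
    have e1 : dist w (a s) = s := by
      rw [← ha.2, ha.1 0 (Set.mem_Ici.2 le_rfl) s hs, zero_sub, abs_neg, abs_of_nonneg hs]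
    have e2 : dist w (k u) = u := by
      rw [← hk.2, hk.1 0 (Set.mem_Ici.2 le_rfl) u hu, zero_sub, abs_neg, abs_of_nonneg hu]
    have e3 : dist (k u) (k s) = |u - s| := hk.1 u hu s hs
    have e4 : |u - s| ≤ C := by
      rw [abs_le]
      constructor
      · linarith [dist_triangle w (k u) (a s), dist_comm (k u) (a s)]
      · linarith [dist_triangle w (a s) (k u)]
    linarith [dist_triangle (a s) (k u) (k s)]
  by_contra hne
  have hpos : 0 < dist (a t) (k t) := dist_pos.2 (fun h => hne h.symm)
  have htpos : 0 < t := by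
    rcases ht.eq_or_lt with rfl | h
    · exact absurd (hk.2.trans ha.2.symm) hne
    · exact h
  obtain ⟨n, hn⟩ := exists_nat_gt (max 1 (2 * C / dist (a t) (k t)))
  have hn1 : (1:ℝ) < n := (le_max_left _ _).trans_lt hn
  have hn2 : 2 * C < n * dist (a t) (k t) :=
    (div_lt_iff₀ hpos).1 ((le_max_right _ _).trans_lt hn)
  have hsub : Set.Icc (0:ℝ) (n * t) ⊆ Set.Ici 0 := fun _ h => h.1
  have hconv := hB.2 0 (n * t) 0 (n * t) a k
    (fun s hs u hu => ha.1 s (hsub hs) u (hsub hu))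
    (fun s hs u hu => hk.1 s (hsub hs) u (hsub hu))
  have hnt : 0 ≤ n * t := by positivity
  have hn0 : (0:ℝ) < n := by linarith
  have key := hconv.2 (show ((0:ℝ), (0:ℝ)) ∈ _ from ⟨⟨le_rfl, hnt⟩, ⟨le_rfl, hnt⟩⟩)
    (show (n * t, n * t) ∈ _ from ⟨⟨hnt, le_rfl⟩, ⟨hnt, le_rfl⟩⟩)
    (show (0:ℝ) ≤ 1 - 1 / n by rw [sub_nonneg, div_le_one hn0]; exact hn1.le)
    (show (0:ℝ) ≤ 1 / n by positivity) (by ring)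
  have e : 1 / (n:ℝ) * (n * t) = t := by field_simp
  simp only [Prod.smul_mk, smul_eq_mul, mul_zero, Prod.mk_add_mk, zero_add, e] at key
  rw [ha.2, hk.2, dist_self, mul_zero, zero_add] at key
  have h3 := hdist (n * t) hnt
  have : n * dist (a t) (k t) ≤ dist (a (n * t)) (k (n * t)) := by
    calc n * dist (a t) (k t) ≤ n * (1 / n * dist (a (n * t)) (k (n * t))) := by gcongr
      _ = _ := by field_simp
  linarith

theorem busemann_eq_limsup (hB : BusemannSpace H) {w : H} {a : ℝ → H}
    (ha : IsRayFrom w a) (x : H) :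
    busemann w a x = limsup (fun t => dist x (a t) - t) atTop := by
  have : { b : ℝ | ∃ k : ℝ → H, IsRayFrom w k ∧ FinHausRays a k ∧
      b = limsup (fun t => dist x (k t) - t) atTop } =
      {limsup (fun t => dist x (a t) - t) atTop} := by
    ext b
    constructor
    · rintro ⟨k, hk, hak, rfl⟩
      refine limsup_congr ?_
      filter_upwards [eventually_ge_atTop 0] with t ht
      rw [hB.ray_unique ha hk hak ht]
    · rintro rfl
      exact ⟨a, ha, ⟨0, fun s hs => ⟨s, hs, by simp⟩, fun t ht => ⟨t, ht, by simp⟩⟩, rfl⟩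
  rw [busemann, this, csSup_singleton]

theorem IsRayFrom.sub_dist_mono {w : H} {a : ℝ → H} (ha : IsRayFrom w a) (x : H)
    {s t : ℝ} (hs : 0 ≤ s) (hst : s ≤ t) : s - dist x (a s) ≤ t - dist x (a t) := by
  have h := ha.1 s hs t (hs.trans hst)
  rw [abs_sub_comm, abs_of_nonneg (by linarith)] at h
  linarith [dist_triangle x (a s) (a t)]

theorem tendsto_height (hB : BusemannSpace H) {w : H} {a : ℝ → H}
    (ha : IsRayFrom w a) (x : H) :
    Tendsto (fun t => t - dist x (a t)) atTop (nhds (height w a x)) := by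
  have hanti : Antitone (fun t : ℝ => dist x (a (max t 0)) - max t 0) := by
    intro s t hst
    have := ha.sub_dist_mono x (le_max_right s 0) (max_le_max_right 0 hst)
    change dist x (a (max t 0)) - max t 0 ≤ dist x (a (max s 0)) - max s 0
    linarith
  have hbdd : BddBelow (Set.range (fun t : ℝ => dist x (a (max t 0)) - max t 0)) := by
    refine ⟨- dist x w, ?_⟩
    rintro _ ⟨t, rfl⟩
    have h := ha.1 0 (Set.mem_Ici.2 le_rfl) (max t 0) (le_max_right t 0)
    rw [ha.2, zero_sub, abs_neg, abs_of_nonneg (le_max_right t 0)] at h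
    change - dist x w ≤ dist x (a (max t 0)) - max t 0
    linarith [dist_triangle w x (a (max t 0)), dist_comm w x]
  have hlim := tendsto_atTop_ciInf hanti hbdd
  have hlim' : Tendsto (fun t => dist x (a t) - t) atTop
      (nhds (⨅ t : ℝ, (dist x (a (max t 0)) - max t 0))) := by
    refine hlim.congr' ?_
    filter_upwards [eventually_ge_atTop 0] with t ht
    rw [max_eq_left ht]
  have h2 := hlim'.neg
  rw [height, busemann_eq_limsup hB ha, hlim'.limsup_eq]
  simpa using h2

theorem sub_dist_le_height (hB : BusemannSpace H) {w : H} {a : ℝ → H}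
    (ha : IsRayFrom w a) (x : H) {t : ℝ} (ht : 0 ≤ t) :
    t - dist x (a t) ≤ height w a x := by
  refine ge_of_tendsto (tendsto_height hB ha x) ?_
  filter_upwards [eventually_ge_atTop t] with s hs
  exact ha.sub_dist_mono x ht hs

theorem height_le_add_dist (hB : BusemannSpace H) {w : H} {a : ℝ → H}
    (ha : IsRayFrom w a) (x y : H) : height w a x ≤ height w a y + dist x y := by
  refine le_of_tendsto_of_tendsto' (tendsto_height hB ha x)
    ((tendsto_height hB ha y).add_const (dist x y)) fun t => ?_
  linarith [dist_triangle y x (a t), dist_comm x y]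

theorem height_lipschitz (hB : BusemannSpace H) {w : H} {a : ℝ → H}
    (ha : IsRayFrom w a) : LipschitzWith 1 (height w a) :=
  LipschitzWith.of_le_add (height_le_add_dist hB ha)

/-- Every pair of points is joined by a geodesic segment rising almost to the height of the
branching point of the vertical rays issued from them. -/
theorem exists_onSegment_high {δ : ℝ} (hδ : 0 < δ) (hH : DeltaHyperbolic H δ)
    (hB : BusemannSpace H) {w : H} {a : ℝ → H} (ha : IsRayFrom w a) (x y : H) :
    ∃ p, OnSegment x y p ∧
      (height w a x + height w a y + dist x y) / 2 - 3 * δ ≤ height w a p := by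
  have hx := (tendsto_height hB ha x).eventually_const_lt
    (show height w a x - δ < height w a x by linarith)
  have hy := (tendsto_height hB ha y).eventually_const_lt
    (show height w a y - δ < height w a y by linarith)
  obtain ⟨t, htx, hty, ht⟩ := (hx.and (hy.and (eventually_ge_atTop 0))).exists
  obtain ⟨p, hp, h1, h2⟩ := hH.exists_center x y (a t)
  refine ⟨p, hp, ?_⟩
  have h3 := sub_dist_le_height hB ha p ht
  have h4 := hp.dist_add_dist
  rw [dist_comm p y] at h4
  linarith

/-! ### Exponential cost of staying low -/

/-- The open integer interval can be split at a point so that neither side carries more than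
half of the total weight. -/
theorem exists_half_split {f : ℕ → ℝ} (hf : ∀ i, 0 ≤ f i) {i k : ℕ} (hik : i + 2 ≤ k) :
    ∃ j, i < j ∧ j < k ∧ 2 * ∑ l ∈ Finset.Ioo i j, f l ≤ ∑ l ∈ Finset.Ioo i k, f l ∧
      2 * ∑ l ∈ Finset.Ioo j k, f l ≤ ∑ l ∈ Finset.Ioo i k, f l := by
  classical
  set W := ∑ l ∈ Finset.Ioo i k, f l with hW
  have hW0 : 0 ≤ W := Finset.sum_nonneg fun l _ => hf l
  have hex : ∃ j, i < j ∧ W ≤ 2 * ∑ l ∈ Finset.Ioo i (j + 1), f l := by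
    refine ⟨k - 1, by omega, ?_⟩
    rw [Nat.sub_add_cancel (by omega)]
    linarith
  obtain ⟨hij, hj⟩ := Nat.find_spec hex
  have hmin : ∀ l, l < Nat.find hex → ¬ (i < l ∧ W ≤ 2 * ∑ l ∈ Finset.Ioo i (l + 1), f l) :=
    fun l hl => Nat.find_min hex hl
  have hjk : Nat.find hex ≤ k - 1 := Nat.find_min' hex (by
    refine ⟨by omega, ?_⟩
    rw [Nat.sub_add_cancel (by omega)]
    linarith)
  generalize Nat.find hex = j at *
  refine ⟨j, hij, by omega, ?_, ?_⟩
  · rcases Nat.lt_or_ge (i + 1) j with h | h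
    · have := hmin (j - 1) (by omega)
      rw [Nat.sub_add_cancel (by omega)] at this
      by_contra hcon
      exact this ⟨by omega, by linarith⟩
    · have : Finset.Ioo i j = ∅ := by
        ext l; simp only [Finset.mem_Ioo, Finset.notMem_empty, iff_false]; omega
      rw [this]
      simpa using hW0
  · have hdisj : Disjoint (Finset.Ioo i (j + 1)) (Finset.Ioo j k) := by
      rw [Finset.disjoint_left]
      intro l hl hl'
      simp only [Finset.mem_Ioo] at hl hl'
      omega
    have hunion : Finset.Ioo i (j + 1) ∪ Finset.Ioo j k = Finset.Ioo i k := by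
      ext l; simp only [Finset.mem_union, Finset.mem_Ioo]; omega
    have : W = ∑ l ∈ Finset.Ioo i (j + 1), f l + ∑ l ∈ Finset.Ioo j k, f l := by
      rw [hW, ← hunion, Finset.sum_union hdisj]
    linarith

theorem two_rpow_sub_mul_div {δ : ℝ} (hδ : 0 < δ) (u c : ℝ) :
    (2:ℝ) ^ ((u - c * δ) / δ) = 2 ^ (u / δ) / 2 ^ c := by
  rw [← Real.rpow_sub (by norm_num)]
  congr 1
  field_simp

/-- If a chain of `δ`-steps stays lower than a point `p` of a geodesic segment joining its
endpoints, then the total weight of its inner vertices, with weight `2 ^ (h / δ)`, is comparable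
to that of `p`. The function `h` is only required to be `1`-Lipschitz. -/
theorem DeltaHyperbolic.rpow_le_sum_chain {δ : ℝ} (hδ : 0 < δ) (hH : DeltaHyperbolic H δ)
    {h : H → ℝ} (hh : LipschitzWith 1 h) (z : ℕ → H) :
    ∀ (n i k : ℕ), k = i + n → (∀ j, i ≤ j → j < k → dist (z j) (z (j + 1)) ≤ δ) →
      ∀ p, OnSegment (z i) (z k) p → (∀ j, i ≤ j → j ≤ k → h (z j) + δ ≤ h p) →
      (2:ℝ) ^ (h p / δ) / 8 ≤ ∑ j ∈ Finset.Ioo i k, (2:ℝ) ^ (h (z j) / δ) := by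
  have hlip : ∀ u v, h u ≤ h v + dist u v := fun u v => by
    have := hh.dist_le_mul u v
    rw [Real.dist_eq, NNReal.coe_one, one_mul] at this
    linarith [le_abs_self (h u - h v)]
  intro n
  induction n using Nat.strong_induction_on with
  | _ n ih =>
  intro i k hk hstep p hp hlow
  have hp' := hp.dist_add_dist
  have hi := hlow i le_rfl (by omega)
  have hk' := hlow k (by omega) le_rfl
  have hpi := hlip p (z i)
  have hpk := hlip p (z k)
  rw [dist_comm] at hpi
  rcases Nat.lt_or_ge n 2 with hn | hn
  · exfalso
    interval_cases n
    · obtain rfl : k = i := by omega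
      rw [dist_self] at hp'
      linarith [dist_nonneg (x := p) (y := z k)]
    · subst hk
      linarith [hstep i le_rfl (by omega)]
  have hpos : ∀ j, 0 ≤ (2:ℝ) ^ (h (z j) / δ) := fun j => by positivity
  have hvertex : ∀ j, i < j → j < k → h p - 3 * δ ≤ h (z j) →
      (2:ℝ) ^ (h p / δ) / 8 ≤ ∑ j ∈ Finset.Ioo i k, (2:ℝ) ^ (h (z j) / δ) := by
    intro j hij hjk hj
    calc (2:ℝ) ^ (h p / δ) / 8 = 2 ^ ((h p - 3 * δ) / δ) := by
          rw [two_rpow_sub_mul_div hδ]; norm_num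
      _ ≤ 2 ^ (h (z j) / δ) := by
          apply Real.rpow_le_rpow_of_exponent_le (by norm_num)
          gcongr
      _ ≤ _ := Finset.single_le_sum (f := fun j => (2:ℝ) ^ (h (z j) / δ))
          (fun j _ => hpos j) (Finset.mem_Ioo.2 ⟨hij, hjk⟩)
  have hnear : ∀ j, i ≤ j → j ≤ k → h p - 2 * δ ≤ h (z j) →
      (2:ℝ) ^ (h p / δ) / 8 ≤ ∑ j ∈ Finset.Ioo i k, (2:ℝ) ^ (h (z j) / δ) := by
    intro j hij hjk hj
    rcases hij.eq_or_lt with rfl | hij'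
    · exact hvertex (i + 1) (by omega) (by omega)
        (by linarith [hlip (z i) (z (i + 1)), hstep i le_rfl (by omega)])
    rcases hjk.eq_or_lt with rfl | hjk'
    · have h1 := hstep (j - 1) (by omega) (by omega)
      rw [Nat.sub_add_cancel (by omega), dist_comm] at h1
      exact hvertex (j - 1) (by omega) (by omega) (by linarith [hlip (z j) (z (j - 1))])
    · exact hvertex j hij' hjk' (by linarith)
  have hsub : ∀ i' k', i ≤ i' → i' ≤ k' → k' ≤ k → k' - i' < n → ∀ q, dist p q ≤ δ →
      OnSegment (z i') (z k') q →
      2 * ∑ j ∈ Finset.Ioo i' k', (2:ℝ) ^ (h (z j) / δ) ≤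
        ∑ j ∈ Finset.Ioo i k, (2:ℝ) ^ (h (z j) / δ) →
      (2:ℝ) ^ (h p / δ) / 8 ≤ ∑ j ∈ Finset.Ioo i k, (2:ℝ) ^ (h (z j) / δ) := by
    intro i' k' h1 h2 h3 h4 q hpq hq hhalf
    have hqp : h p - δ ≤ h q := by linarith [hlip p q]
    by_cases hall : ∀ j, i' ≤ j → j ≤ k' → h (z j) + δ ≤ h q
    · have := ih (k' - i') h4 i' k' (by omega)
        (fun j a b => hstep j (by omega) (by omega)) q hq hall
      have h5 : (2:ℝ) ^ (h p / δ) / 2 ≤ 2 ^ (h q / δ) := by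
        calc (2:ℝ) ^ (h p / δ) / 2 = 2 ^ ((h p - 1 * δ) / δ) := by
              rw [two_rpow_sub_mul_div hδ, Real.rpow_one]
          _ ≤ _ := by
              apply Real.rpow_le_rpow_of_exponent_le (by norm_num)
              gcongr
              linarith
      linarith
    · push Not at hall
      obtain ⟨j, h5, h6, h7⟩ := hall
      exact hnear j (by omega) (by omega) (by linarith)
  obtain ⟨j, hij, hjk, hl, hr⟩ := exists_half_split hpos (show i + 2 ≤ k by omega)
  obtain ⟨q, hpq, hq | hq⟩ := hH.exists_onSegment hp (z j)
  · exact hsub i j le_rfl hij.le hjk.le (by omega) q hpq hq hl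
  · exact hsub j k hij.le hjk.le le_rfl (by omega) q hpq hq hr

/-! ### Discretisation of a path -/

theorem exists_next_time {α : ℝ → H} {T δ : ℝ} (hδ : 0 < δ)
    (hα : ContinuousOn α (Set.Icc 0 T)) {t : ℝ} (ht : t ∈ Set.Icc 0 T) :
    ∃ t' ∈ Set.Icc t T, (∀ s ∈ Set.Icc t t', dist (α t) (α s) ≤ δ) ∧
      (t' < T → dist (α t) (α t') = δ) := by
  have hcont : ∀ v ≤ T, ContinuousOn (fun s => dist (α t) (α s)) (Set.Icc t v) := fun v hv =>
    (continuous_const.dist continuous_id).comp_continuousOn (hα.mono (Set.Icc_subset_Icc ht.1 hv))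
  have hivt : ∀ v ∈ Set.Icc t T, δ < dist (α t) (α v) →
      ∃ u ∈ Set.Icc t v, dist (α t) (α u) = δ := fun v hv hlt =>
    intermediate_value_Icc hv.1 (hcont v hv.2) ⟨by simpa using hδ.le, hlt.le⟩
  by_cases hall : ∀ s ∈ Set.Icc t T, dist (α t) (α s) ≤ δ
  · exact ⟨T, ⟨ht.2, le_rfl⟩, hall, fun h => absurd h (lt_irrefl _)⟩
  push Not at hall
  obtain ⟨v, hv, hlt⟩ := hall
  obtain ⟨u, hu, hud⟩ := hivt v hv hlt
  have hS : IsCompact (Set.Icc t T ∩ (fun s => dist (α t) (α s)) ⁻¹' {δ}) :=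
    isCompact_Icc.of_isClosed_subset
      ((hcont T le_rfl).preimage_isClosed_of_isClosed isClosed_Icc isClosed_singleton)
      Set.inter_subset_left
  obtain ⟨t', ⟨ht', hd⟩, hleast⟩ := hS.exists_isLeast ⟨u, ⟨hu.1, hu.2.trans hv.2⟩, hud⟩
  have hd : dist (α t) (α t') = δ := hd
  refine ⟨t', ht', fun s hs => ?_, fun _ => hd⟩
  by_contra! hcon
  obtain ⟨r, hr, hrd⟩ := hivt s ⟨hs.1, hs.2.trans ht'.2⟩ hcon
  have hrt : t' ≤ r := hleast ⟨⟨hr.1, hr.2.trans (hs.2.trans ht'.2)⟩, hrd⟩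
  have : s = t' := le_antisymm hs.2 (hrt.trans hr.2)
  rw [this, hd] at hcon
  exact lt_irrefl _ hcon

/-- A rectifiable path can be cut into finitely many pieces, each contained in the `δ`-ball
around its starting point, and all but the last having endpoints at distance exactly `δ`. -/
theorem exists_subdivision {α : ℝ → H} {T δ : ℝ} (hδ : 0 < δ) (hT : 0 ≤ T)
    (hα : ContinuousOn α (Set.Icc 0 T)) (hfin : eVariationOn α (Set.Icc 0 T) ≠ ⊤) :
    ∃ (t : ℕ → ℝ) (n : ℕ), Monotone t ∧ (∀ i, t i ∈ Set.Icc 0 T) ∧ t 0 = 0 ∧ t n = T ∧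
      (∀ i, ∀ s ∈ Set.Icc (t i) (t (i + 1)), dist (α (t i)) (α s) ≤ δ) ∧
      (∀ i, i + 1 < n → dist (α (t i)) (α (t (i + 1))) = δ) := by
  classical
  choose! f hf1 hf2 hf3 using fun t (ht : t ∈ Set.Icc 0 T) => exists_next_time hδ hα ht
  let t : ℕ → ℝ := fun i => f^[i] 0
  have hsucc : ∀ i, t (i + 1) = f (t i) := fun i => Function.iterate_succ_apply' f i 0
  have hmem : ∀ i, t i ∈ Set.Icc 0 T := by
    intro i
    induction i with
    | zero => exact ⟨le_rfl, hT⟩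
    | succ i ih =>
      rw [hsucc]
      exact ⟨ih.1.trans (hf1 _ ih).1, (hf1 _ ih).2⟩
  have hmono : Monotone t := monotone_nat_of_le_succ fun i => by
    rw [hsucc]
    exact (hf1 _ (hmem i)).1
  have hex : ∃ n, t n = T := by
    by_contra! hne
    have hd : ∀ i, edist (α (t (i + 1))) (α (t i)) = ENNReal.ofReal δ := fun i => by
      rw [edist_comm, edist_dist, hsucc,
        hf3 _ (hmem i) (lt_of_le_of_ne (hf1 _ (hmem i)).2 (by rw [← hsucc]; exact hne _))]
    obtain ⟨n, hn⟩ := exists_nat_gt ((eVariationOn α (Set.Icc 0 T)).toReal / δ)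
    rw [div_lt_iff₀ hδ] at hn
    have hle := eVariationOn.sum_le (f := α) (s := Set.Icc 0 T) (n := n) hmono hmem
    simp only [hd, Finset.sum_const, Finset.card_range, nsmul_eq_mul] at hle
    have := ENNReal.toReal_mono hfin hle
    rw [ENNReal.toReal_mul, ENNReal.toReal_natCast, ENNReal.toReal_ofReal hδ.le] at this
    linarith
  refine ⟨t, Nat.find hex, hmono, hmem, rfl, Nat.find_spec hex, fun i s hs => ?_,
    fun i hi => ?_⟩
  · rw [hsucc] at hs
    exact hf2 _ (hmem i) s hs
  · rw [hsucc]
    refine hf3 _ (hmem i) (lt_of_le_of_ne (hf1 _ (hmem i)).2 ?_)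
    rw [← hsucc]
    exact Nat.find_min hex hi

theorem exists_mem_subdivision {t : ℕ → ℝ} {n : ℕ} {s : ℝ} (h0 : t 0 ≤ s) (hn : s ≤ t n) :
    s = t 0 ∨ ∃ i < n, s ∈ Set.Icc (t i) (t (i + 1)) := by
  induction n with
  | zero => exact Or.inl (le_antisymm hn h0)
  | succ n ih =>
    rcases le_total s (t n) with h | h
    · exact (ih h).imp_right fun ⟨i, hi, hs⟩ => ⟨i, by omega, hs⟩
    · exact Or.inr ⟨n, by omega, h, hn⟩

/-! ### Vertical cost -/

/-- The height `u` corrected by a term which compensates the exponential weight. -/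
def correctedHeight (M δ u : ℝ) : ℝ := u - δ * 2 ^ ((u - M) / δ)

theorem correctedHeight_le {M δ u : ℝ} (hδ : 0 < δ) : correctedHeight M δ u ≤ u := by
  have : (0:ℝ) < δ * 2 ^ ((u - M) / δ) := by positivity
  rw [correctedHeight]
  linarith

theorem two_rpow_div_le_one {δ u : ℝ} (hδ : 0 < δ) (hu : u ≤ 0) : (2:ℝ) ^ (u / δ) ≤ 1 :=
  Real.rpow_le_one_of_one_le_of_nonpos (by norm_num) (div_nonpos_of_nonpos_of_nonneg hu hδ.le)

theorem sub_le_correctedHeight {M δ u : ℝ} (hδ : 0 < δ) (hu : u ≤ M) :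
    u - δ ≤ correctedHeight M δ u := by
  have := two_rpow_div_le_one hδ (sub_nonpos.2 hu)
  rw [correctedHeight]
  nlinarith

theorem two_rpow_le_one_add {x : ℝ} (h0 : 0 ≤ x) (h1 : x ≤ 1) : (2:ℝ) ^ x ≤ 1 + x := by
  have := rpow_one_add_le_one_add_mul_self (s := 1) (by norm_num) h0 h1
  norm_num at this
  linarith

theorem one_add_half_le_two_rpow {x : ℝ} (h0 : 0 ≤ x) : 1 + x / 2 ≤ (2:ℝ) ^ x := by
  rw [Real.rpow_def_of_pos (by norm_num)]
  have h1 := Real.add_one_le_exp (Real.log 2 * x)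
  have h2 := Real.log_two_gt_d9
  nlinarith

theorem two_rpow_neg_le {x : ℝ} (h0 : 0 ≤ x) (h1 : x ≤ 1) : (2:ℝ) ^ (-x) ≤ 1 - x / 2 := by
  have h2 := two_rpow_le_one_add (x := 1 - x) (by linarith) (by linarith)
  have h3 : (2:ℝ) ^ (1 - x) = 2 * 2 ^ (-x) := by
    rw [sub_eq_add_neg, Real.rpow_add (by norm_num), Real.rpow_one]
  linarith

theorem one_sub_le_two_rpow_neg {x : ℝ} (h0 : 0 ≤ x) : 1 - x ≤ (2:ℝ) ^ (-x) := by
  rw [Real.rpow_def_of_pos (by norm_num)]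
  have h1 := Real.add_one_le_exp (Real.log 2 * -x)
  have h2 := Real.log_two_lt_d9
  nlinarith

theorem abs_correctedHeight_sub_le {M δ u v : ℝ} (hδ : 0 < δ) (hu : u ≤ M)
    (huv : |v - u| ≤ δ) :
    |correctedHeight M δ v - correctedHeight M δ u| ≤
      (1 - 2 ^ ((u - M) / δ) / 2) * |v - u| := by
  have hr1 := two_rpow_div_le_one hδ (sub_nonpos.2 hu)
  have hr0 : (0:ℝ) < 2 ^ ((u - M) / δ) := by positivity
  have hsplit : (2:ℝ) ^ ((v - M) / δ) = 2 ^ ((u - M) / δ) * 2 ^ ((v - u) / δ) := by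
    rw [← Real.rpow_add (by norm_num)]
    congr 1
    ring
  have heq : correctedHeight M δ v - correctedHeight M δ u =
      δ * ((v - u) / δ - 2 ^ ((u - M) / δ) * (2 ^ ((v - u) / δ) - 1)) := by
    rw [correctedHeight, correctedHeight, hsplit]
    field_simp
    ring
  obtain ⟨x, hx⟩ : ∃ x, x = (v - u) / δ := ⟨_, rfl⟩
  have hvu : v - u = δ * x := by rw [hx]; field_simp
  have hx1 : |x| ≤ 1 := by
    rw [hx, abs_div, abs_of_pos hδ, div_le_one hδ]
    exact huv
  rw [heq, ← hx, hvu, abs_mul, abs_mul, abs_of_pos hδ, mul_left_comm]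
  refine mul_le_mul_of_nonneg_left ?_ hδ.le
  generalize (2:ℝ) ^ ((u - M) / δ) = r at hr1 hr0
  rcases le_total 0 x with h | h
  · rw [abs_of_nonneg h] at hx1 ⊢
    have h1 := two_rpow_le_one_add h hx1
    have h2 := one_add_half_le_two_rpow h
    rw [abs_le]
    constructor <;> nlinarith
  · rw [abs_of_nonpos h] at hx1 ⊢
    have h1 := two_rpow_neg_le (x := -x) (by linarith) hx1
    have h2 := one_sub_le_two_rpow_neg (x := -x) (by linarith)
    rw [neg_neg] at h1 h2
    rw [abs_le]
    constructor <;> nlinarith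

/-- The total variation of a finite sequence which visits a low value `g k` and a high value
`g l`, in either order. -/
theorem le_sum_abs_sub (g : ℕ → ℝ) {n k l : ℕ} (hk : k ≤ n) (hl : l ≤ n) :
    2 * g l - 2 * g k - |g n - g 0| ≤
      ∑ i ∈ Finset.range n, |g (i + 1) - g i| := by
  have hvar : ∀ i j, i ≤ j → |g j - g i| ≤ ∑ m ∈ Finset.Ico i j, |g (m + 1) - g m| := by
    intro i j hij
    have := dist_le_Ico_sum_dist g hij
    rw [dist_comm, Real.dist_eq] at this
    refine this.trans_eq (Finset.sum_congr rfl fun m _ => ?_)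
    rw [dist_comm, Real.dist_eq]
  have hcut : ∀ i j, i ≤ j → j ≤ n →
      |g i - g 0| + |g j - g i| + |g n - g j| ≤ ∑ i ∈ Finset.range n, |g (i + 1) - g i| := by
    intro i j hij hjn
    rw [← Nat.Ico_zero_eq_range, ← Finset.sum_Ico_consecutive _ (Nat.zero_le j) hjn,
      ← Finset.sum_Ico_consecutive _ (Nat.zero_le i) hij]
    linarith [hvar 0 i (Nat.zero_le i), hvar i j hij, hvar j n hjn]
  rcases le_total k l with h | h
  · have := hcut k l h hl
    linarith [neg_abs_le (g k - g 0), le_abs_self (g l - g k), neg_abs_le (g n - g l),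
      le_abs_self (g n - g 0), abs_nonneg (g n - g 0)]
  · have := hcut l k h hk
    linarith [le_abs_self (g l - g 0), neg_abs_le (g k - g l), le_abs_self (g n - g k),
      neg_abs_le (g n - g 0), abs_nonneg (g n - g 0)]

/-- Lower bound for the length of a chain of `δ`-steps by its vertical cost plus the total
exponential weight of its inner vertices. -/
theorem chain_length_lower_bound {δ M : ℝ} (hδ : 0 < δ) {h : H → ℝ} (hh : LipschitzWith 1 h)
    (z : ℕ → H) {n k l : ℕ} (hk : k ≤ n) (hl : l ≤ n) (hM : ∀ i, h (z i) ≤ M)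
    (hstep : ∀ i, dist (z i) (z (i + 1)) ≤ δ)
    (hexact : ∀ i, i + 1 < n → dist (z i) (z (i + 1)) = δ) :
    2 * h (z l) - 2 * h (z k) - |h (z n) - h (z 0)| - 4 * δ +
        δ / 2 * ∑ i ∈ Finset.Ioo 0 n, (2:ℝ) ^ ((h (z i) - M) / δ) ≤
      ∑ i ∈ Finset.range n, dist (z i) (z (i + 1)) := by
  have habs : ∀ i, |h (z (i + 1)) - h (z i)| ≤ dist (z i) (z (i + 1)) := fun i => by
    have := hh.dist_le_mul (z i) (z (i + 1))
    rwa [Real.dist_eq, NNReal.coe_one, one_mul, abs_sub_comm] at this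
  have hr0 : ∀ i, (0:ℝ) ≤ 2 ^ ((h (z i) - M) / δ) := fun i => by positivity
  have hr1 : ∀ i, (2:ℝ) ^ ((h (z i) - M) / δ) ≤ 1 := fun i =>
    two_rpow_div_le_one hδ (sub_nonpos.2 (hM i))
  have hvert := le_sum_abs_sub (fun i => correctedHeight M δ (h (z i))) hk hl
  have hterm : ∀ i, |correctedHeight M δ (h (z (i + 1))) - correctedHeight M δ (h (z i))| +
      2 ^ ((h (z i) - M) / δ) / 2 * dist (z i) (z (i + 1)) ≤ dist (z i) (z (i + 1)) := by
    intro i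
    have h1 := abs_correctedHeight_sub_le hδ (hM i) ((habs i).trans (hstep i))
    have h2 := mul_le_mul_of_nonneg_left (habs i)
      (show (0:ℝ) ≤ 1 - 2 ^ ((h (z i) - M) / δ) / 2 by linarith [hr1 i])
    linarith
  have hsum := Finset.sum_le_sum (s := Finset.range n) fun i _ => hterm i
  rw [Finset.sum_add_distrib] at hsum
  have hweight : δ / 2 * ∑ i ∈ Finset.Ioo 0 n, (2:ℝ) ^ ((h (z i) - M) / δ) - δ / 2 ≤
      ∑ i ∈ Finset.range n, 2 ^ ((h (z i) - M) / δ) / 2 * dist (z i) (z (i + 1)) := by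
    rcases n with _ | n
    · simp; linarith
    have h1 : ∑ i ∈ Finset.Ioo 0 (n + 1), (2:ℝ) ^ ((h (z i) - M) / δ) ≤
        ∑ i ∈ Finset.range (n + 1), (2:ℝ) ^ ((h (z i) - M) / δ) := by
      refine Finset.sum_le_sum_of_subset_of_nonneg (fun i hi => ?_) fun i _ _ => hr0 i
      rw [Finset.mem_Ioo] at hi
      exact Finset.mem_range.2 hi.2
    rw [Finset.sum_range_succ] at h1 ⊢
    have h2 : ∑ i ∈ Finset.range n, 2 ^ ((h (z i) - M) / δ) / 2 * dist (z i) (z (i + 1)) =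
        δ / 2 * ∑ i ∈ Finset.range n, (2:ℝ) ^ ((h (z i) - M) / δ) := by
      rw [Finset.mul_sum]
      refine Finset.sum_congr rfl fun i hi => ?_
      rw [hexact i (by have := Finset.mem_range.1 hi; omega)]
      ring
    have h3 : 0 ≤ 2 ^ ((h (z n) - M) / δ) / 2 * dist (z n) (z (n + 1)) :=
      mul_nonneg (by linarith [hr0 n]) dist_nonneg
    rw [h2]
    have h4 := mul_le_mul_of_nonneg_left (h1.trans (add_le_add_right (hr1 n) _))
      (show 0 ≤ δ / 2 by linarith)
    linarith
  have h5 := sub_le_correctedHeight hδ (hM l)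
  have h6 := correctedHeight_le (M := M) (u := h (z k)) hδ
  have h7 : |correctedHeight M δ (h (z n)) - correctedHeight M δ (h (z 0))| ≤
      |h (z n) - h (z 0)| + δ := by
    have a1 := sub_le_correctedHeight hδ (hM n)
    have a2 := sub_le_correctedHeight hδ (hM 0)
    have a3 := correctedHeight_le (M := M) (u := h (z n)) hδ
    have a4 := correctedHeight_le (M := M) (u := h (z 0)) hδ
    rw [abs_le]
    constructor <;> linarith [neg_abs_le (h (z n) - h (z 0)), le_abs_self (h (z n) - h (z 0))]
  linarith

/-- Lower bound on the length of a path which goes down to the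
height of `m` before reaching `y`. -/
theorem statement8 {H : Type*} [MetricSpace H] [ProperSpace H]
    (δ : ℝ) (hδ : 1 ≤ δ) (hH : DeltaHyperbolic H δ) (hB : BusemannSpace H)
    (w : H) (a : ℝ → H) (ha : IsRayFrom w a)
    (x y m : H) (hmx : height w a m ≤ height w a x) (hxy : height w a x ≤ height w a y)
    (T : ℝ) (hT : 0 ≤ T) (α : ℝ → H) (hαc : ContinuousOn α (Set.Icc 0 T))
    (hα0 : α 0 = x) (hαT : α T = y)
    (hmin : hminusOn w a α (Set.Icc 0 T) = height w a m)
    (ΔH : ℝ)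
    (hΔH : ΔH = height w a y + dr w a x y / 2 - hplusOn w a α (Set.Icc 0 T)) :
    ENNReal.ofReal (2 * dh w a x m + dist x y + 2 ^ (-(850:ℝ)) * 2 ^ (ΔH / δ)
        - 1 - max 0 (2 * ΔH) - 1700 * δ)
      ≤ eVariationOn α (Set.Icc 0 T) := by
  have hδ0 : 0 < δ := by linarith
  have hlip := height_lipschitz hB ha
  have habs : ∀ u v, height w a u ≤ height w a v + dist u v := height_le_add_dist hB ha
  by_cases hfin : eVariationOn α (Set.Icc 0 T) = ⊤
  · rw [hfin]
    exact le_top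
  obtain ⟨t, n, htmono, htmem, ht0, htn, hball, hexact⟩ :=
    exists_subdivision hδ0 hT hαc hfin
  have hhc : ContinuousOn (fun s => height w a (α s)) (Set.Icc 0 T) :=
    hlip.continuous.comp_continuousOn hαc
  have hne : (Set.Icc 0 T).Nonempty := ⟨0, le_rfl, hT⟩
  obtain ⟨s₁, hs₁, hmax, hmax'⟩ := isCompact_Icc.exists_sSup_image_eq_and_ge hne hhc
  obtain ⟨s₂, hs₂, hmin', -⟩ := isCompact_Icc.exists_sInf_image_eq_and_le hne hhc
  rw [← hminusOn, hmin] at hmin'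
  rw [← hplusOn] at hmax
  rw [hmax] at hΔH
  set M := height w a (α s₁)
  have hvertex : ∀ s ∈ Set.Icc 0 T, ∃ i ≤ n, dist (α (t i)) (α s) ≤ δ := by
    intro s hs
    rcases exists_mem_subdivision (n := n) (ht0.trans_le hs.1) (hs.2.trans_eq htn.symm) with
      rfl | ⟨i, hi, hsi⟩
    · exact ⟨0, Nat.zero_le _, by simpa using hδ0.le⟩
    · exact ⟨i, hi.le, hball i s hsi⟩
  obtain ⟨l, hl, hld⟩ := hvertex s₁ hs₁
  obtain ⟨k, hk, hkd⟩ := hvertex s₂ hs₂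
  have hstep : ∀ i, dist (α (t i)) (α (t (i + 1))) ≤ δ := fun i =>
    hball i _ ⟨htmono (Nat.le_succ i), le_rfl⟩
  have hchain := chain_length_lower_bound (M := M) hδ0 hlip (fun i => α (t i)) hk hl
    (fun i => hmax' _ (htmem i)) hstep hexact
  simp only [ht0, htn, hα0, hαT] at hchain
  have hvar : ENNReal.ofReal (∑ i ∈ Finset.range n, dist (α (t i)) (α (t (i + 1)))) ≤
      eVariationOn α (Set.Icc 0 T) := by
    rw [ENNReal.ofReal_sum_of_nonneg fun _ _ => dist_nonneg]
    refine le_trans (le_of_eq (Finset.sum_congr rfl fun i _ => ?_))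
      (eVariationOn.sum_le (f := α) (n := n) htmono htmem)
    rw [← edist_dist, edist_comm]
  refine le_trans (ENNReal.ofReal_le_ofReal (le_trans ?_ hchain)) hvar
  have hlM : M - δ ≤ height w a (α (t l)) := by
    linarith [habs (α s₁) (α (t l)), dist_comm (α s₁) (α (t l))]
  have hkm : height w a (α (t k)) ≤ height w a m + δ := by
    linarith [habs (α (t k)) (α s₂)]
  have hweight : (2:ℝ) ^ (-(850:ℝ)) * 2 ^ (ΔH / δ) - 1 ≤
      δ / 2 * ∑ i ∈ Finset.Ioo 0 n, (2:ℝ) ^ ((height w a (α (t i)) - M) / δ) := by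
    have hsum0 : 0 ≤ ∑ i ∈ Finset.Ioo 0 n, (2:ℝ) ^ ((height w a (α (t i)) - M) / δ) :=
      Finset.sum_nonneg fun i _ => by positivity
    rw [← Real.rpow_add (by norm_num)]
    rcases le_total ΔH (850 * δ) with hsmall | hbig
    · have : (2:ℝ) ^ (-850 + ΔH / δ) ≤ 1 := by
        refine Real.rpow_le_one_of_one_le_of_nonpos (by norm_num) ?_
        rw [← div_le_iff₀ hδ0] at hsmall
        linarith
      have := mul_nonneg (show 0 ≤ δ / 2 by linarith) hsum0
      linarith
    · obtain ⟨p, hp, hph⟩ := exists_onSegment_high hδ0 hH hB ha x y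
      have hpM : ΔH - 3 * δ ≤ height w a p - M := by
        rw [dr, dh, abs_sub_comm, abs_of_nonneg (sub_nonneg.2 hxy)] at hΔH
        linarith
      have hexp := hH.rpow_le_sum_chain hδ0 hlip (fun i => α (t i)) n 0 n (by simp)
        (fun j _ _ => hstep j) p (by simpa only [ht0, htn, hα0, hαT] using hp)
        (fun j _ _ => by
          have := hmax' _ (htmem j)
          linarith)
      have hscale : ∑ i ∈ Finset.Ioo 0 n, (2:ℝ) ^ ((height w a (α (t i)) - M) / δ) =
          (∑ i ∈ Finset.Ioo 0 n, (2:ℝ) ^ (height w a (α (t i)) / δ)) / 2 ^ (M / δ) := by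
        rw [Finset.sum_div]
        refine Finset.sum_congr rfl fun i _ => ?_
        rw [sub_div, Real.rpow_sub (by norm_num)]
      have h1 : (2:ℝ) ^ ((height w a p - M) / δ) / 8 ≤
          ∑ i ∈ Finset.Ioo 0 n, (2:ℝ) ^ ((height w a (α (t i)) - M) / δ) := by
        rw [hscale, sub_div, Real.rpow_sub (by norm_num), div_right_comm]
        gcongr
      have h2 : (2:ℝ) ^ (-850 + ΔH / δ) * 16 ≤ 2 ^ ((height w a p - M) / δ) := by
        have : (16:ℝ) = 2 ^ (4:ℝ) := by norm_num
        rw [this, ← Real.rpow_add (by norm_num)]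
        refine Real.rpow_le_rpow_of_exponent_le (by norm_num) ?_
        have h3 : (ΔH - 3 * δ) / δ ≤ (height w a p - M) / δ := by gcongr
        have h4 : (ΔH - 3 * δ) / δ = ΔH / δ - 3 := by field_simp
        linarith
      nlinarith
  rw [dr, dh, abs_sub_comm, abs_of_nonneg (sub_nonneg.2 hxy)] at hΔH
  rw [dh, abs_of_nonneg (sub_nonneg.2 hmx), abs_of_nonneg (sub_nonneg.2 hxy)]
  linarith [le_max_right 0 (2 * ΔH)]

end HP

end
end

section
/- Let δ ≥ 1, let N be an admissible norm, and let H_p, H_q be proper, geodesically complete, δ-hyperbolic, Busemann spaces. Let V = (V_p, V_q) : ℝ → H_p⋈H_q be a geodesic of (H_p⋈H_q, d_{H,N}). Then V is a vertical geodesic of (H_p⋈H_q, d_{H,N}) if and only if V_p and V_q are vertical geodesics of H_p and H_q respectively. -/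
open Set Filter
open scoped ENNReal NNReal

noncomputable section

namespace HP

variable {H : Type*} [MetricSpace H]

variable {Hp Hq : Type*} [MetricSpace Hp] [MetricSpace Hq]

lemma dist_le_of_same_start (hB : BusemannSpace H) {γ γ' : ℝ → H} {a a' L τ : ℝ}
    (hL : 0 < L) (hτ : τ ∈ Set.Icc 0 L)
    (hγ : IsGeodesicOn γ (Set.Icc a (a + L))) (hγ' : IsGeodesicOn γ' (Set.Icc a' (a' + L)))
    (h0 : γ a = γ' a') :
    dist (γ (a + τ)) (γ' (a' + τ)) ≤ τ / L * dist (γ (a + L)) (γ' (a' + L)) := by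
  have hc := hB.2 a (a + L) a' (a' + L) γ γ' hγ hγ'
  have hle : τ / L ≤ 1 := (div_le_one hL).2 hτ.2
  have hnn : 0 ≤ τ / L := div_nonneg hτ.1 hL.le
  have hmul : τ / L * L = τ := div_mul_cancel₀ _ hL.ne'
  have h := hc.2 (show (a, a') ∈ _ by simp [hL.le]) (show (a + L, a' + L) ∈ _ by simp [hL.le])
    (sub_nonneg.2 hle) hnn (sub_add_cancel 1 _)
  simp only [Prod.smul_mk, Prod.mk_add_mk, smul_eq_mul, h0, dist_self, mul_zero, zero_add] at h
  have e1 : (1 - τ / L) * a + τ / L * (a + L) = a + τ := by linear_combination hmul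
  have e2 : (1 - τ / L) * a' + τ / L * (a' + L) = a' + τ := by linear_combination hmul
  rwa [e1, e2] at h

lemma IsGeodesicOn.mono {γ : ℝ → H} {I J : Set ℝ} (h : IsGeodesicOn γ J) (hIJ : I ⊆ J) :
    IsGeodesicOn γ I :=
  fun s hs t ht => h s (hIJ hs) t (hIJ ht)

lemma IsGeodesicRay.dist_zero {γ : ℝ → H} (h : IsGeodesicRay γ) {t : ℝ} (ht : 0 ≤ t) :
    dist (γ 0) (γ t) = t := by
  rw [h 0 (by simp) t ht, zero_sub, abs_neg, abs_of_nonneg ht]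

/-- Points of two rays at distance at most `C` have comparable parameters. -/
lemma IsGeodesicRay.dist_le_of_dist_le {γ γ' : ℝ → H} (h : IsGeodesicRay γ)
    (h' : IsGeodesicRay γ') {C s t : ℝ} (hs : 0 ≤ s) (ht : 0 ≤ t)
    (hC : dist (γ s) (γ' t) ≤ C) :
    dist (γ s) (γ' s) ≤ 2 * C + dist (γ 0) (γ' 0) := by
  have h1 := h.dist_zero hs
  have h2 := h'.dist_zero ht
  have h3 : dist (γ' t) (γ' s) = |t - s| := h' t ht s hs
  have h4 := dist_triangle4 (γ 0) (γ' 0) (γ' t) (γ s)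
  have h5 := dist_triangle4 (γ' 0) (γ 0) (γ s) (γ' t)
  have h6 := dist_triangle (γ s) (γ' t) (γ' s)
  rw [dist_comm (γ' t) (γ s)] at h4
  rw [dist_comm (γ' 0) (γ 0)] at h5
  have h7 : |t - s| ≤ C + dist (γ 0) (γ' 0) := abs_le.2 ⟨by linarith, by linarith⟩
  linarith

/-- In a Busemann space, a ray is determined by its origin and its boundary point. -/
lemma eq_of_finHausRays (hB : BusemannSpace H) {w : H} {γ γ' : ℝ → H}
    (h : IsRayFrom w γ) (h' : IsRayFrom w γ') (hf : FinHausRays γ γ') {t : ℝ} (ht : 0 ≤ t) :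
    γ t = γ' t := by
  obtain ⟨C, hC, -⟩ := hf
  have hbd : ∀ s, 0 ≤ s → dist (γ s) (γ' s) ≤ 2 * C := fun s hs => by
    obtain ⟨u, hu, hd⟩ := hC s hs
    simpa [h.2, h'.2] using h.1.dist_le_of_dist_le h'.1 hs hu hd
  have hlim : Tendsto (fun L : ℝ => t / L * (2 * C)) atTop (nhds 0) := by
    simpa using (tendsto_const_nhds.div_atTop tendsto_id).mul_const (2 * C)
  refine dist_le_zero.1 (ge_of_tendsto hlim ?_)
  filter_upwards [eventually_ge_atTop t, eventually_gt_atTop 0] with L hLt hL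
  have := dist_le_of_same_start hB (a := 0) (a' := 0) hL ⟨ht, hLt⟩
    (h.1.mono fun x hx => hx.1) (h'.1.mono fun x hx => hx.1) (h.2.trans h'.2.symm)
  simp only [zero_add] at this
  exact this.trans (mul_le_mul_of_nonneg_left (hbd L hL.le) (by positivity))

lemma IsRayFrom.exists_tendsto_dist_sub {w : H} {k : ℝ → H} (hk : IsRayFrom w k) (x : H) :
    ∃ b, Tendsto (fun t => dist x (k t) - t) atTop (nhds b) := by
  have hanti : Antitone (fun t : ℝ => dist x (k (max t 0)) - max t 0) := by
    intro s t hst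
    have hm : max s 0 ≤ max t 0 := max_le_max_right 0 hst
    have h1 := hk.1 (max s 0) (le_max_right s 0) (max t 0) (le_max_right t 0)
    rw [abs_sub_comm, abs_of_nonneg (sub_nonneg.2 hm)] at h1
    have h2 := dist_triangle x (k (max s 0)) (k (max t 0))
    dsimp only
    linarith
  have hbdd : BddBelow (Set.range fun t : ℝ => dist x (k (max t 0)) - max t 0) := by
    refine ⟨-dist (k 0) x, ?_⟩
    rintro _ ⟨t, rfl⟩
    have h1 := hk.1.dist_zero (le_max_right t 0)
    have h2 := dist_triangle (k 0) x (k (max t 0))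
    dsimp only
    linarith
  refine ⟨_, (tendsto_atTop_ciInf hanti hbdd).congr' ?_⟩
  filter_upwards [eventually_ge_atTop 0] with t ht
  rw [max_eq_left ht]

/-- In a Busemann space the Busemann function is a limit along the representing ray. -/
lemma tendsto_busemann (hB : BusemannSpace H) {w : H} {k : ℝ → H} (hk : IsRayFrom w k) (x : H) :
    Tendsto (fun t => dist x (k t) - t) atTop (nhds (busemann w k x)) := by
  obtain ⟨b, hb⟩ := hk.exists_tendsto_dist_sub x
  suffices h : busemann w k x = b by rwa [h]
  have hset : { c : ℝ | ∃ k' : ℝ → H, IsRayFrom w k' ∧ FinHausRays k k' ∧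
      c = Filter.limsup (fun t => dist x (k' t) - t) Filter.atTop } = {b} := by
    ext c
    simp only [Set.mem_ofPred_eq, Set.mem_singleton_iff]
    constructor
    · rintro ⟨k', hk', hf, rfl⟩
      refine (hb.congr' ?_).limsup_eq
      filter_upwards [eventually_ge_atTop 0] with t ht
      rw [eq_of_finHausRays hB hk hk' hf ht]
    · rintro rfl
      exact ⟨k, hk, ⟨0, fun s hs => ⟨s, hs, by simp⟩, fun t ht => ⟨t, ht, by simp⟩⟩,
        hb.limsup_eq.symm⟩
  rw [busemann, hset, csSup_singleton]

lemma busemann_le_add_dist (hB : BusemannSpace H) {w : H} {k : ℝ → H} (hk : IsRayFrom w k)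
    (x y : H) : busemann w k x ≤ busemann w k y + dist x y := by
  refine le_of_tendsto_of_tendsto' (tendsto_busemann hB hk x)
    ((tendsto_busemann hB hk y).add_const (dist x y)) fun t => ?_
  linarith [dist_triangle x y (k t)]

lemma abs_height_sub_le (hB : BusemannSpace H) {w : H} {k : ℝ → H} (hk : IsRayFrom w k)
    (x y : H) : |height w k x - height w k y| ≤ dist x y := by
  have h1 := busemann_le_add_dist hB hk x y
  have h2 := busemann_le_add_dist hB hk y x
  rw [dist_comm y x] at h2
  simp only [height]
  exact abs_le.2 ⟨by linarith, by linarith⟩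

lemma exists_dist_le_of_segment_to_ray (hB : BusemannSpace H) {k γ : ℝ → H} {o : H} {s τ : ℝ}
    (hk : IsGeodesicRay k) (hs : 0 ≤ s) (hγ : IsGeodSegment γ (k s) o)
    (hτ : τ ∈ Set.Icc 0 (dist (k s) o)) :
    ∃ u, 0 ≤ u ∧ dist (γ τ) (k u) ≤ dist o (k 0) := by
  obtain ⟨hg, h0, h1⟩ := hγ
  set L := dist (k s) o with hLdef
  have hL : 0 ≤ L := dist_nonneg
  have hnn : 0 ≤ τ / L := div_nonneg hτ.1 hL
  have hle : τ / L ≤ 1 := div_le_one_of_le₀ hτ.2 hL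
  have hmul : τ / L * L = τ := by
    rcases hL.eq_or_lt with h | h
    · have : τ = 0 := le_antisymm (h ▸ hτ.2) hτ.1
      simp [this]
    · exact div_mul_cancel₀ _ h.ne'
  have hc := hB.2 0 L 0 s γ k hg (hk.mono fun x hx => hx.1)
  have h := hc.2 (show (0, s) ∈ _ by simp [hL, hs]) (show (L, 0) ∈ _ by simp [hL, hs])
    (sub_nonneg.2 hle) hnn (sub_add_cancel 1 _)
  simp only [Prod.smul_mk, Prod.mk_add_mk, smul_eq_mul, h0, h1, dist_self, mul_zero, zero_add,
    add_zero, hmul] at h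
  exact ⟨(1 - τ / L) * s, mul_nonneg (by linarith) hs,
    h.trans (mul_le_of_le_one_left dist_nonneg hle)⟩

/-- A geodesic ray of a hyperbolic Busemann space whose height tends to `+∞` stays at bounded
distance from the ray representing the chosen boundary point. -/
lemma exists_dist_ray_le {δ : ℝ} (hH : DeltaHyperbolic H δ) (hB : BusemannSpace H)
    {w : H} {k : ℝ → H} (hk : IsRayFrom w k) {R : ℝ → H} (hR : IsGeodesicRay R)
    (hV : Tendsto (fun t => height w k (R t)) atTop atTop) :
    ∃ C, ∀ r, 0 ≤ r → dist (R r) (k r) ≤ C := by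
  refine ⟨2 * (δ + dist (R 0) (k 0)) + dist (R 0) (k 0), fun r hr => ?_⟩
  suffices h : ∃ u, 0 ≤ u ∧ dist (R r) (k u) ≤ δ + dist (R 0) (k 0) by
    obtain ⟨u, hu, hd⟩ := h
    exact hR.dist_le_of_dist_le hk.1 hr hu hd
  obtain ⟨t, hth, htr, htδ⟩ := ((hV.eventually_gt_atTop (height w k (R 0))).and
    ((eventually_ge_atTop r).and (eventually_gt_atTop (2 * r + 2 * δ)))).exists
  have hb : busemann w k (R t) < busemann w k (R 0) := by simpa [height] using hth
  obtain ⟨s, hlt, hs⟩ := (((tendsto_busemann hB hk (R t)).eventually_lt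
    (tendsto_busemann hB hk (R 0)) hb).and (eventually_ge_atTop 0)).exists
  have ht : 0 ≤ t := hr.trans htr
  have hdt := hR.dist_zero ht
  obtain ⟨γ₂, hγ₂⟩ := hH.1 (R t) (k s)
  obtain ⟨γ₃, hγ₃⟩ := hH.1 (k s) (R 0)
  have hγ₁ : IsGeodSegment R (R 0) (R t) :=
    ⟨hR.mono fun x hx => hx.1, rfl, by rw [hdt]⟩
  obtain ⟨u, hu, hd⟩ := hH.2 _ _ _ R γ₂ γ₃ hγ₁ hγ₂ hγ₃ r ⟨hr, by rwa [hdt]⟩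
  rcases hu with ⟨v, hv, rfl⟩ | ⟨v, hv, rfl⟩
  · exfalso
    obtain ⟨hg, h0, h1⟩ := hγ₂
    have e1 := hg 0 ⟨le_rfl, dist_nonneg⟩ v hv
    have e2 := hg v hv (dist (R t) (k s)) ⟨dist_nonneg, le_rfl⟩
    rw [h0, zero_sub, abs_neg, abs_of_nonneg hv.1] at e1
    rw [h1, abs_sub_comm, abs_of_nonneg (sub_nonneg.2 hv.2)] at e2
    have e3 : dist (R r) (R t) = t - r := by
      rw [hR r hr t ht, abs_sub_comm, abs_of_nonneg (sub_nonneg.2 htr)]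
    have e4 := hR.dist_zero hr
    have e5 := dist_triangle (R r) (γ₂ v) (R t)
    have e6 := dist_triangle4 (R 0) (R r) (γ₂ v) (k s)
    rw [dist_comm (γ₂ v) (R t)] at e5
    linarith
  · obtain ⟨u, hu, hdk⟩ := exists_dist_le_of_segment_to_ray hB hk.1 hs hγ₃ hv
    exact ⟨u, hu, (dist_triangle _ _ _).trans (add_le_add hd hdk)⟩

/-- Along a ray asymptotic to the chosen boundary point, the Busemann function decreases at unit
speed. -/
lemma busemann_le_sub (hB : BusemannSpace H)
    {w : H} {k : ℝ → H} (hk : IsRayFrom w k) {R : ℝ → H} (hR : IsGeodesicRay R)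
    {C : ℝ} (hC : ∀ r, 0 ≤ r → dist (R r) (k r) ≤ C) {τ : ℝ} (hτ : 0 ≤ τ) :
    busemann w k (R τ) ≤ busemann w k (R 0) - τ := by
  set D := dist (R 0) (k 0) with hD
  have hL : Tendsto (fun n : ℝ => dist (R 0) (k n)) atTop atTop := by
    refine tendsto_atTop_mono' _ ?_ (tendsto_atTop_add_const_right _ (-D) tendsto_id)
    filter_upwards [eventually_ge_atTop 0] with n hn
    have h1 := hk.1.dist_zero hn
    have h2 := dist_triangle (k 0) (R 0) (k n)
    rw [dist_comm (k 0) (R 0)] at h2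
    simp only [id]
    linarith
  have hlim : Tendsto (fun n : ℝ => (dist (R 0) (k n) - n) - τ
      + τ / dist (R 0) (k n) * (D + C)) atTop (nhds (busemann w k (R 0) - τ)) := by
    simpa using ((tendsto_busemann hB hk (R 0)).sub_const τ).add
      ((tendsto_const_nhds.div_atTop hL).mul_const (D + C))
  refine le_of_tendsto_of_tendsto (tendsto_busemann hB hk (R τ)) hlim ?_
  filter_upwards [eventually_ge_atTop 0, hL.eventually_gt_atTop 0, hL.eventually_ge_atTop τ]
    with n hn hpos hge
  obtain ⟨σ, hσ, h0, h1⟩ := hB.1 (R 0) (k n)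
  set L := dist (R 0) (k n) with hLdef
  have hc := dist_le_of_same_start hB (a := 0) (a' := 0) (γ := R) (γ' := σ) hpos ⟨hτ, hge⟩
    (hR.mono fun x hx => hx.1) (by simpa using hσ) h0.symm
  simp only [zero_add, h1] at hc
  have e1 : dist (σ τ) (k n) = L - τ := by
    have := hσ τ ⟨hτ, hge⟩ L ⟨hpos.le, le_rfl⟩
    rw [h1] at this
    rw [this, abs_sub_comm, abs_of_nonneg (sub_nonneg.2 hge)]
  have e2 : dist (R L) (R n) = |L - n| := hR L hpos.le n hn
  have e3 : |L - n| ≤ D := by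
    have h1 := hk.1.dist_zero hn
    have h2 := dist_triangle (k 0) (R 0) (k n)
    have h3 := dist_triangle (R 0) (k 0) (k n)
    rw [dist_comm (k 0) (R 0)] at h2
    exact abs_le.2 ⟨by linarith, by linarith⟩
  have e4 : dist (R L) (k n) ≤ D + C := by
    linarith [dist_triangle (R L) (R n) (k n), hC n hn]
  have e5 := mul_le_mul_of_nonneg_left e4 (div_nonneg hτ hpos.le)
  linarith [dist_triangle (R τ) (σ τ) (k n)]

lemma height_eq_add_of_tendsto {δ : ℝ} (hH : DeltaHyperbolic H δ) (hB : BusemannSpace H)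
    {w : H} {k : ℝ → H} (hk : IsRayFrom w k) {V : ℝ → H} (hV : IsGeodesicLine V)
    (hh : Tendsto (fun t => height w k (V t)) atTop atTop) (t : ℝ) :
    height w k (V t) = t + height w k (V 0) := by
  have key : ∀ a τ : ℝ, 0 ≤ τ → height w k (V (a + τ)) = height w k (V a) + τ := by
    intro a τ hτ
    have hR : IsGeodesicRay (fun r => V (a + r)) := fun s _ t _ => by
      rw [hV _ trivial _ trivial, add_sub_add_left_eq_sub]
    obtain ⟨C, hC⟩ := exists_dist_ray_le hH hB hk hR
      (hh.comp (tendsto_atTop_add_const_left _ a tendsto_id))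
    have h1 := busemann_le_sub hB hk hR hC hτ
    have h2 := busemann_le_add_dist hB hk (V a) (V (a + τ))
    rw [hV _ trivial _ trivial, sub_add_cancel_left, abs_neg, abs_of_nonneg hτ] at h2
    simp only [add_zero] at h1
    simp only [height]
    linarith
  rcases le_total 0 t with ht | ht
  · simpa [add_comm] using key 0 t ht
  · have := key t (-t) (by linarith)
    rw [add_neg_cancel] at this
    linarith

lemma IsVerticalGeodesicLine.exists_height_eq {δ : ℝ} (hH : DeltaHyperbolic H δ)
    (hB : BusemannSpace H) {w : H} {k : ℝ → H} (hk : IsRayFrom w k) {V : ℝ → H}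
    (hV : IsVerticalGeodesicLine w k V) :
    ∃ c : ℝ, (∀ t, height w k (V t) = t + c) ∨ (∀ t, height w k (V t) = c - t) := by
  obtain ⟨hl, hh | hh⟩ := hV
  · exact ⟨_, Or.inl (height_eq_add_of_tendsto hH hB hk hl hh)⟩
  · have hl' : IsGeodesicLine (fun t => V (-t)) := fun s _ t _ => by
      rw [hl _ trivial _ trivial, neg_sub_neg, abs_sub_comm]
    refine ⟨height w k (V 0), Or.inr fun t => ?_⟩
    have := height_eq_add_of_tendsto hH hB hk hl' (hh.comp tendsto_neg_atTop_atBot) (-t)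
    simp only [neg_neg, neg_zero] at this
    linarith

lemma ofReal_le_dHN (Nf : ℝ × ℝ → ℝ) (mem : Hp × Hq → Prop) (x y : Hp × Hq) :
    ENNReal.ofReal (Nf (dist y.1 x.1, dist y.2 x.2)) ≤ dHN Nf mem x y := by
  refine le_iInf fun T => le_iInf fun hT => le_iInf fun γ => le_iInf fun _ => le_iInf fun _ =>
    le_iInf fun h0 => le_iInf fun h1 => ?_
  let u : ℕ → ℝ := fun i => if i = 0 then 0 else T
  have hu : Monotone u := monotone_nat_of_le_succ fun n => by
    by_cases hn : n = 0 <;> simp [u, hn, hT]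
  have hmem : ∀ i, u i ∈ Set.Icc 0 T := fun i => by
    by_cases hi : i = 0 <;> simp [u, hi, hT]
  refine le_trans ?_ (le_iSup _ (1, ⟨u, hu, hmem⟩))
  simp [u, h0, h1]

/-- A geodesic of the horospherical product whose height varies at unit speed projects to
geodesic lines in both factors. -/
lemma IsHNGeodesicOn.isGeodesicLine_of_height (hBp : BusemannSpace Hp) (hBq : BusemannSpace Hq)
    {wp : Hp} {ap : ℝ → Hp} (hap : IsRayFrom wp ap) {wq : Hq} {aq : ℝ → Hq}
    (haq : IsRayFrom wq aq) (N : AdmNorm) {V : ℝ → Hp × Hq}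
    (hV : IsHNGeodesicOn N.toFun (inHoro wp ap wq aq) V Set.univ)
    (hh : ∀ s t, |height wp ap (V s).1 - height wp ap (V t).1| = |s - t|) :
    IsGeodesicLine (fun t => (V t).1) ∧ IsGeodesicLine (fun t => (V t).2) := by
  have key : ∀ s t, dist (V s).1 (V t).1 = |s - t| ∧ dist (V s).2 (V t).2 = |s - t| := by
    intro s t
    have h1 := abs_height_sub_le hBp hap (V s).1 (V t).1
    have h2 := abs_height_sub_le hBq haq (V s).2 (V t).2
    have ms : height wq aq (V s).2 = - height wp ap (V s).1 := by
      linarith [show height wp ap (V s).1 + height wq aq (V s).2 = 0 from hV.1 s trivial]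
    have mt : height wq aq (V t).2 = - height wp ap (V t).1 := by
      linarith [show height wp ap (V t).1 + height wq aq (V t).2 = 0 from hV.1 t trivial]
    rw [ms, mt, neg_sub_neg, abs_sub_comm] at h2
    rw [hh s t] at h1 h2
    have h3 := ofReal_le_dHN N.toFun (inHoro wp ap wq aq) (V t) (V s)
    rw [hV.2 t trivial s trivial, ENNReal.ofReal_le_ofReal_iff (abs_nonneg _),
      abs_sub_comm] at h3
    have h4 := N.adm (dist (V s).1 (V t).1) (dist (V s).2 (V t).2)
    constructor <;> linarith
  exact ⟨fun s _ t _ => (key s t).1, fun s _ t _ => (key s t).2⟩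

/-- A geodesic `V = (V_p, V_q)` of the horospherical product is a
vertical geodesic (i.e. admits an arclength parametrisation with `h(V(t)) = t`)
iff its components are vertical geodesics of the factors. -/
theorem statement9 {Hp Hq : Type*} [MetricSpace Hp] [MetricSpace Hq]
    [ProperSpace Hp] [ProperSpace Hq]
    (δ : ℝ) (hδ : 1 ≤ δ)
    (hHp : DeltaHyperbolic Hp δ) (hHq : DeltaHyperbolic Hq δ)
    (hBp : BusemannSpace Hp) (hBq : BusemannSpace Hq)
    (hGp : GeodesicallyComplete Hp) (hGq : GeodesicallyComplete Hq)
    (wp : Hp) (ap : ℝ → Hp) (hap : IsRayFrom wp ap)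
    (wq : Hq) (aq : ℝ → Hq) (haq : IsRayFrom wq aq)
    (N : AdmNorm)
    (V : ℝ → Hp × Hq)
    (hV : IsHNGeodesicOn N.toFun (inHoro wp ap wq aq) V Set.univ) :
    (∃ c : ℝ, (∀ t : ℝ, height wp ap (V t).1 = t + c) ∨
              (∀ t : ℝ, height wp ap (V t).1 = c - t)) ↔
    (IsVerticalGeodesicLine wp ap (fun t => (V t).1) ∧
     IsVerticalGeodesicLine wq aq (fun t => (V t).2)) := by
  constructor
  · rintro ⟨c, hc⟩
    have hq : ∀ t, height wq aq (V t).2 = - height wp ap (V t).1 := fun t => by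
      linarith [show height wp ap (V t).1 + height wq aq (V t).2 = 0 from hV.1 t trivial]
    have hlines := hV.isGeodesicLine_of_height hBp hBq hap haq N fun s t => by
      rcases hc with h | h
      · rw [h, h, add_sub_add_right_eq_sub]
      · rw [h, h, sub_sub_sub_cancel_left, abs_sub_comm]
    rcases hc with h | h
    · refine ⟨⟨hlines.1, Or.inl ?_⟩, ⟨hlines.2, Or.inr ?_⟩⟩
      · simpa only [h, id] using tendsto_atTop_add_const_right atTop c tendsto_id
      · simpa only [hq, h, Function.comp_def, id] using tendsto_neg_atBot_atTop.comp
          (tendsto_atBot_add_const_right atBot c tendsto_id)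
    · refine ⟨⟨hlines.1, Or.inr ?_⟩, ⟨hlines.2, Or.inl ?_⟩⟩
      · simpa only [h, sub_eq_add_neg] using
          tendsto_atTop_add_const_left atBot c tendsto_neg_atBot_atTop
      · simpa only [hq, h, neg_sub, ← sub_eq_add_neg, id] using
          tendsto_atTop_add_const_right atTop (-c) tendsto_id
  · exact fun h => h.1.exists_height_eq hHp hBp hap

end HP

end
end
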